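/- Let L be a d-generator generalized Heisenberg Lie algebra over a field k with d ≥ 3 and dim L² = ½d(d−1) − 2. Then the subspace K of L² ⊗ (L/L²) spanned by the elements [x,y]⊗(z+L²) + [z,x]⊗(y+L²) + [y,z]⊗(x+L²) for x, y, z ∈ L has dimension exactly (1/6)d(d−1)(d−2). -/

import Mathlib

open Module TensorProduct

variable (k : Type*) [Field k]

/-- The derived subalgebra `L² = [L,L]` of a Lie algebra, as a `k`-submodule. -/
abbrev lieSq (L : Type*) [LieRing L] [LieAlgebra k L] : Submodule k L :=
  (LieModule.lowerCentralSeries k L L 1).toSubmodule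

lemma lie_mem_lieSq {L : Type*} [LieRing L] [LieAlgebra k L] (x y : L) :
    ⁅x, y⁆ ∈ lieSq k L := by
  have : ⁅x, y⁆ ∈ LieModule.lowerCentralSeries k L L 1 := by
    rw [LieModule.lowerCentralSeries_succ, LieModule.lowerCentralSeries_zero]
    exact LieSubmodule.lie_mem_lie (LieSubmodule.mem_top x) (LieSubmodule.mem_top y)
  exact this

/-- The subspace `K` of `L² ⊗ (L/L²)` spanned by the elements
`[x,y]⊗z̄ + [z,x]⊗ȳ + [y,z]⊗x̄`. -/
abbrev Ksub (L : Type*) [LieRing L] [LieAlgebra k L] :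
    Submodule k (TensorProduct k (lieSq k L) (L ⧸ lieSq k L)) :=
  Submodule.span k
    { t | ∃ x y z : L,
      t = (⟨⁅x, y⁆, lie_mem_lieSq k x y⟩ : lieSq k L) ⊗ₜ[k]
            (Submodule.Quotient.mk z : L ⧸ lieSq k L)
        + (⟨⁅z, x⁆, lie_mem_lieSq k z x⟩ : lieSq k L) ⊗ₜ[k]
            (Submodule.Quotient.mk y : L ⧸ lieSq k L)
        + (⟨⁅y, z⁆, lie_mem_lieSq k y z⟩ : lieSq k L) ⊗ₜ[k]
            (Submodule.Quotient.mk x : L ⧸ lieSq k L) }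

section Trivectors

variable {k} {V W : Type*} [AddCommGroup V] [Module k V]
  [AddCommGroup W] [Module k W]

/-- The wedge product of two vectors, as a bilinear map. -/
noncomputable def wedge : V →ₗ[k] V →ₗ[k] ⋀[k]^2 V :=
  LinearMap.mk₂ k (fun x y => exteriorPower.ιMulti k 2 ![x, y])
    (fun x x' y => (exteriorPower.ιMulti k 2).map_vecCons_add ![y] x x')
    (fun c x y => (exteriorPower.ιMulti k 2).map_vecCons_smul ![y] c x)
    (fun x y y' => ((exteriorPower.ιMulti k 2).curryLeft x).map_vecCons_add ![] y y')
    (fun c x y => ((exteriorPower.ιMulti k 2).curryLeft x).map_vecCons_smul ![] c y)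

lemma wedge_apply (x y : V) : wedge (k := k) x y = exteriorPower.ιMulti k 2 ![x, y] := rfl

lemma wedge_self (x : V) : wedge (k := k) x x = 0 :=
  (exteriorPower.ιMulti k 2).map_eq_zero_of_eq ![x, x] (i := 0) (j := 1) rfl (by decide)

/-- The alternating map `(x, y, z) ↦ B x y ⊗ z + B z x ⊗ y + B y z ⊗ x` attached to an
alternating bilinear map `B`. -/
noncomputable def cyclicTensor (B : V →ₗ[k] V →ₗ[k] W) (hB : ∀ x, B x x = 0) :
    V [⋀^Fin 3]→ₗ[k] W ⊗[k] V :=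
  { MultilinearMap.mk' (fun v : Fin 3 → V =>
      B (v 0) (v 1) ⊗ₜ[k] v 2 + B (v 2) (v 0) ⊗ₜ[k] v 1 + B (v 1) (v 2) ⊗ₜ[k] v 0)
      (fun v i x y => by
        fin_cases i <;>
        simp [TensorProduct.tmul_add, TensorProduct.add_tmul] <;> abel)
      (fun v i c x => by
        fin_cases i <;>
        simp [TensorProduct.smul_tmul']) with
    map_eq_zero_of_eq' := fun v i j h hij => by
      have hswap (x y : V) : B x y + B y x = 0 := by
        simpa [hB] using hB (x + y)
      fin_cases i <;> fin_cases j <;>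
      first
      | exact absurd rfl hij
      | (simp at h
         simp [h, hB, ← TensorProduct.add_tmul, hswap]) }

/-- The linear map `⋀³ V → ⋀² V ⊗ V` (comultiplication). -/
noncomputable def trivectorComul : ⋀[k]^3 V →ₗ[k] (⋀[k]^2 V) ⊗[k] V :=
  exteriorPower.alternatingMapLinearEquiv (cyclicTensor wedge wedge_self)

lemma trivectorComul_ιMulti (v : Fin 3 → V) :
    trivectorComul (exteriorPower.ιMulti k 3 v) =
      wedge (k := k) (v 0) (v 1) ⊗ₜ[k] v 2 + wedge (k := k) (v 2) (v 0) ⊗ₜ[k] v 1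
        + wedge (k := k) (v 1) (v 2) ⊗ₜ[k] v 0 := by
  simp [trivectorComul, cyclicTensor]

/-- Contraction of a trivector with a linear form. -/
noncomputable def trivectorContract (f : Dual k V) : ⋀[k]^3 V →ₗ[k] ⋀[k]^2 V :=
  (TensorProduct.rid k _).toLinearMap ∘ₗ f.lTensor _ ∘ₗ trivectorComul

lemma trivectorContract_ιMulti (f : Dual k V) (v : Fin 3 → V) :
    trivectorContract f (exteriorPower.ιMulti k 3 v) =
      f (v 2) • wedge (v 0) (v 1) + f (v 1) • wedge (v 2) (v 0) + f (v 0) • wedge (v 1) (v 2) := by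
  simp [trivectorContract, trivectorComul_ιMulti]

lemma alternatingMapToDual_trivectorContract (f g h : Dual k V) (ω : ⋀[k]^3 V) :
    exteriorPower.alternatingMapToDual k V 2 ![f, g] (trivectorContract h ω) =
      exteriorPower.alternatingMapToDual k V 3 ![f, g, h] ω := by
  suffices exteriorPower.alternatingMapToDual k V 2 ![f, g] ∘ₗ trivectorContract h =
      exteriorPower.alternatingMapToDual k V 3 ![f, g, h] from LinearMap.congr_fun this ω
  ext v
  simp [trivectorContract_ιMulti, wedge_apply, Matrix.det_fin_two, Matrix.det_fin_three]
  ring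

lemma exists_alternatingMapToDual_ne_zero {n : ℕ} {ω : ⋀[k]^n V} (hω : ω ≠ 0) :
    ∃ f : Fin n → Dual k V, exteriorPower.alternatingMapToDual k V n f ω ≠ 0 := by
  classical
  let : LinearOrder (Module.Free.ChooseBasisIndex k V) := linearOrderOfSTO WellOrderingRel
  let b := Module.Free.chooseBasis k V
  by_contra! h
  refine hω ((b.exteriorPower n).ext_elem fun s => ?_)
  rw [exteriorPower.basis_repr_apply, map_zero, Finsupp.zero_apply]
  simpa [exteriorPower.ιMultiDual, exteriorPower.ιMulti_family, exteriorPower.pairingDual]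
    using h _

lemma exists_linearIndependent_trivectorContract {ω : ⋀[k]^3 V} (hω : ω ≠ 0) :
    ∃ f : Fin 3 → Dual k V, LinearIndependent k fun i => trivectorContract (f i) ω := by
  obtain ⟨f, hf⟩ := exists_alternatingMapToDual_ne_zero hω
  refine ⟨f, Fintype.linearIndependent_iff.2 fun c hc => ?_⟩
  have key (a b : Fin 3) : c 0 * exteriorPower.alternatingMapToDual k V 3 ![f a, f b, f 0] ω
      + c 1 * exteriorPower.alternatingMapToDual k V 3 ![f a, f b, f 1] ω
      + c 2 * exteriorPower.alternatingMapToDual k V 3 ![f a, f b, f 2] ω = 0 := by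
    simpa [Fin.sum_univ_three, alternatingMapToDual_trivectorContract] using
      congrArg (exteriorPower.alternatingMapToDual k V 2 ![f a, f b]) hc
  have hzero (v : Fin 3 → Dual k V) (i j : Fin 3) (h : v i = v j) (hij : i ≠ j) :
      exteriorPower.alternatingMapToDual k V 3 v ω = 0 := by
    rw [AlternatingMap.map_eq_zero_of_eq _ v h hij, LinearMap.zero_apply]
  have hperm (σ : Equiv.Perm (Fin 3)) :
      exteriorPower.alternatingMapToDual k V 3 (f ∘ σ) ω ≠ 0 := by
    rw [AlternatingMap.map_perm]
    rcases Int.units_eq_one_or (Equiv.Perm.sign σ) with h | h <;> simpa [h] using hf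
  have e0 : ![f 1, f 2, f 0] = f ∘ finRotate 3 := by ext i : 1; fin_cases i <;> rfl
  have e1 : ![f 0, f 2, f 1] = f ∘ Equiv.swap 1 2 := by ext i : 1; fin_cases i <;> rfl
  have e2 : ![f 0, f 1, f 2] = f := by ext i : 1; fin_cases i <;> rfl
  have h0 := key 1 2
  have h1 := key 0 2
  have h2 := key 0 1
  rw [hzero ![f 1, f 2, f 1] 0 2 rfl (by decide), hzero ![f 1, f 2, f 2] 1 2 rfl (by decide),
    e0] at h0
  rw [hzero ![f 0, f 2, f 0] 0 2 rfl (by decide), hzero ![f 0, f 2, f 2] 1 2 rfl (by decide),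
    e1] at h1
  rw [hzero ![f 0, f 1, f 0] 0 2 rfl (by decide), hzero ![f 0, f 1, f 1] 1 2 rfl (by decide),
    e2] at h2
  intro i
  fin_cases i
  · simpa [hperm] using h0
  · simpa [hperm] using h1
  · simpa [hf] using h2

/-- A linear map on bivectors with kernel of dimension at most two induces an injective map
on trivectors. -/
lemma rTensor_comp_trivectorComul_injective [FiniteDimensional k V] (β : ⋀[k]^2 V →ₗ[k] W)
    (hβ : finrank k (LinearMap.ker β) ≤ 2) :
    Function.Injective (β.rTensor V ∘ₗ trivectorComul) := by
  rw [← LinearMap.ker_eq_bot, LinearMap.ker_eq_bot']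
  intro ω hω
  by_contra hne
  obtain ⟨f, hf⟩ := exists_linearIndependent_trivectorContract hne
  have hmem (i : Fin 3) : trivectorContract (f i) ω ∈ LinearMap.ker β := by
    have hcomm : β ∘ₗ (TensorProduct.rid k _).toLinearMap ∘ₗ (f i).lTensor _ =
        (TensorProduct.rid k W).toLinearMap ∘ₗ (f i).lTensor _ ∘ₗ β.rTensor V := by
      ext; simp
    have := LinearMap.congr_fun hcomm (trivectorComul ω)
    simp only [LinearMap.comp_apply] at this hω
    rw [hω] at this
    simpa [trivectorContract] using this
  have hli : LinearIndependent k
      (fun i => (⟨trivectorContract (f i) ω, hmem i⟩ : LinearMap.ker β)) :=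
    LinearIndependent.of_comp (LinearMap.ker β).subtype hf
  have := hli.fintype_card_le_finrank
  rw [Fintype.card_fin] at this
  lia

end Trivectors

section Bracket

variable {k} {L : Type*} [LieRing L] [LieAlgebra k L]

/-- The bracket of `L` as a bilinear map into the derived subalgebra. -/
noncomputable def bracketToLieSq : L →ₗ[k] L →ₗ[k] lieSq k L :=
  LinearMap.mk₂ k (fun x y => ⟨⁅x, y⁆, lie_mem_lieSq k x y⟩)
    (fun _ _ _ => Subtype.ext (add_lie _ _ _)) (fun _ _ _ => Subtype.ext (smul_lie _ _ _))
    (fun _ _ _ => Subtype.ext (lie_add _ _ _)) (fun _ _ _ => Subtype.ext (lie_smul _ _ _))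

/-- The bilinear map on `L / L²` induced by the bracket when `L²` is central. -/
noncomputable def quotientBracket
    (hH : LieModule.lowerCentralSeries k L L 1 ≤ LieAlgebra.center k L) :
    (L ⧸ lieSq k L) →ₗ[k] (L ⧸ lieSq k L) →ₗ[k] lieSq k L :=
  (lieSq k L).liftQ
    (LinearMap.flip ((lieSq k L).liftQ (bracketToLieSq (k := k) (L := L)).flip fun y hy => by
      ext x
      exact (LieModule.mem_maxTrivSubmodule k L L y).1 (hH hy) x))
    fun x hx => by
      ext y
      change ⁅x, y⁆ = 0
      rw [← lie_skew, (LieModule.mem_maxTrivSubmodule k L L x).1 (hH hx) y, neg_zero]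

lemma quotientBracket_mk
    (hH : LieModule.lowerCentralSeries k L L 1 ≤ LieAlgebra.center k L) (x y : L) :
    quotientBracket hH (Submodule.Quotient.mk x) (Submodule.Quotient.mk y) =
      ⟨⁅x, y⁆, lie_mem_lieSq k x y⟩ := rfl

/-- The linear map `⋀² (L / L²) → L²` induced by the bracket when `L²` is central. -/
noncomputable def bivectorBracket
    (hH : LieModule.lowerCentralSeries k L L 1 ≤ LieAlgebra.center k L) :
    ⋀[k]^2 (L ⧸ lieSq k L) →ₗ[k] lieSq k L :=
  exteriorPower.alternatingMapLinearEquiv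
    { MultilinearMap.mk' (fun v : Fin 2 → L ⧸ lieSq k L => quotientBracket hH (v 0) (v 1))
        (fun v i x y => by fin_cases i <;> simp)
        (fun v i c x => by fin_cases i <;> simp) with
      map_eq_zero_of_eq' := fun v i j h hij => by
        have h01 : v 0 = v 1 := by
          fin_cases i <;> fin_cases j <;> first | exact absurd rfl hij | exact h | exact h.symm
        change quotientBracket hH (v 0) (v 1) = 0
        rw [h01]
        obtain ⟨x, hx⟩ := Submodule.Quotient.mk_surjective _ (v 1)
        rw [← hx, quotientBracket_mk]
        exact Subtype.ext (lie_self x) }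

lemma bivectorBracket_wedge_mk
    (hH : LieModule.lowerCentralSeries k L L 1 ≤ LieAlgebra.center k L) (x y : L) :
    bivectorBracket hH (wedge (Submodule.Quotient.mk x) (Submodule.Quotient.mk y)) =
      ⟨⁅x, y⁆, lie_mem_lieSq k x y⟩ := by
  simp [bivectorBracket, wedge_apply, quotientBracket_mk]

lemma bivectorBracket_surjective
    (hH : LieModule.lowerCentralSeries k L L 1 ≤ LieAlgebra.center k L) :
    Function.Surjective (bivectorBracket hH) := by
  have hle : lieSq k L ≤ (LinearMap.range (bivectorBracket hH)).map (lieSq k L).subtype := by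
    have hspan : lieSq k L = Submodule.span k
        { m | ∃ x ∈ (⊤ : LieIdeal k L), ∃ n ∈ (⊤ : LieSubmodule k L L), ⁅x, n⁆ = m } := by
      rw [lieSq, LieModule.lowerCentralSeries_succ, LieModule.lowerCentralSeries_zero,
        LieSubmodule.lieIdeal_oper_eq_linear_span']
    refine hspan.le.trans (Submodule.span_le.2 ?_)
    rintro _ ⟨x, -, y, -, rfl⟩
    exact ⟨⟨⁅x, y⁆, lie_mem_lieSq k x y⟩, ⟨_, bivectorBracket_wedge_mk hH x y⟩, rfl⟩
  intro z
  obtain ⟨w, hw, hwz⟩ := hle z.2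
  obtain rfl : w = z := Subtype.ext hwz
  exact hw

lemma range_rTensor_comp_trivectorComul
    (hH : LieModule.lowerCentralSeries k L L 1 ≤ LieAlgebra.center k L) :
    LinearMap.range ((bivectorBracket hH).rTensor _ ∘ₗ trivectorComul) = Ksub k L := by
  rw [LinearMap.range_eq_map, ← exteriorPower.ιMulti_span, Submodule.map_span, Ksub]
  congr 1
  ext t
  constructor
  · rintro ⟨_, ⟨v, rfl⟩, rfl⟩
    choose x hx using fun i => Submodule.Quotient.mk_surjective (lieSq k L) (v i)
    refine ⟨x 0, x 1, x 2, ?_⟩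
    simp [trivectorComul_ιMulti, ← hx, bivectorBracket_wedge_mk]
  · rintro ⟨x, y, z, rfl⟩
    refine ⟨_, ⟨![Submodule.Quotient.mk x, Submodule.Quotient.mk y, Submodule.Quotient.mk z],
      rfl⟩, ?_⟩
    simp [trivectorComul_ιMulti, bivectorBracket_wedge_mk]

end Bracket

/-- For a `d`-generator generalized Heisenberg Lie algebra with `d ≥ 3` and `dim L² = ½d(d−1) − 2`, the subspace `K` has dimension `d(d−1)(d−2)/6`. -/
theorem stmt6 (L : Type*) [LieRing L] [LieAlgebra k L] [FiniteDimensional k L]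
    (d : ℕ) (hd3 : 3 ≤ d)
    (hH : LieModule.lowerCentralSeries k L L 1 = LieAlgebra.center k L)
    (hgen : finrank k (L ⧸ lieSq k L) = d)
    (hrk : finrank k (lieSq k L) = d * (d - 1) / 2 - 2) :
    finrank k (Ksub k L) = d * (d - 1) * (d - 2) / 6 := by
  have hinj : Function.Injective
      ((bivectorBracket hH.le).rTensor (L ⧸ lieSq k L) ∘ₗ trivectorComul) := by
    apply rTensor_comp_trivectorComul_injective
    have h := LinearMap.finrank_range_add_finrank_ker (bivectorBracket hH.le)
    rw [LinearMap.range_eq_top.2 (bivectorBracket_surjective hH.le), finrank_top,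
      exteriorPower.finrank_eq, hgen, hrk, Nat.choose_two_right] at h
    lia
  rw [← range_rTensor_comp_trivectorComul hH.le, LinearMap.finrank_range_of_inj hinj,
    exteriorPower.finrank_eq, hgen, Nat.choose_eq_descFactorial_div_factorial]
  congr 1
  simp [Nat.descFactorial]
  ring
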